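/- arXiv:2007.13468 — 2 statements merged into one kernel-verified Lean document; each statement's English description precedes it below -/
import Mathlib

section
/- Assume the Seifert data. Let k be an integer with 0 < k < m and set θ = k/m. Then the map l ↦ (b₁k + a₁l, b₂k − a₂l) is a bijection from the set of integers l satisfying s₁k/m < l < −s₂k/m onto the set of lattice points {(x,y) ∈ ℤ² ∩ Π(a,b,c,d) : u(x,y) = θ}, where (a,b) = (a₁n + m₁, m₂) and (c,d) = (m₁, a₂n + m₂). In particular, the number of integers l with s₁k/m < l < −s₂k/m equals M_θ⁺. -/
open scoped Classical

/-- The open parallelogram spanned by `(a,b)` and `(c,d)`. -/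
def para (a b c d : ℤ) : Set (ℝ × ℝ) :=
  {P | ∃ s t : ℝ, 0 < s ∧ s < 1 ∧ 0 < t ∧ t < 1 ∧
    P = (s * a + t * c, s * b + t * d)}

/-- The linear function with `u(a,b) = u(c,d) = 1`. -/
noncomputable def uFun (a b c d : ℤ) (P : ℝ × ℝ) : ℝ :=
  (((d : ℝ) - b) * P.1 + ((a : ℝ) - c) * P.2) / ((a : ℝ) * d - b * c)

/-- The number of lattice points in the open parallelogram on which `u` takes the value `θ`. -/
noncomputable def Mcount (a b c d : ℤ) (θ : ℝ) : ℕ :=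
  {p : ℤ × ℤ | ((p.1 : ℝ), (p.2 : ℝ)) ∈ para a b c d ∧
    uFun a b c d ((p.1 : ℝ), (p.2 : ℝ)) = θ}.ncard

/-- Cramer's rule description of the open parallelogram. -/
theorem mem_para_iff {a b c d : ℤ} (h : (0 : ℝ) < a * d - b * c) (x y : ℝ) :
    (x, y) ∈ para a b c d ↔
      (0 < d * x - c * y ∧ d * x - c * y < a * d - b * c) ∧
        (0 < a * y - b * x ∧ a * y - b * x < a * d - b * c) := by
  constructor
  · rintro ⟨s, t, hs0, hs1, ht0, ht1, hP⟩
    obtain ⟨rfl, rfl⟩ := Prod.mk.inj hP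
    have e₁ : (d : ℝ) * (s * a + t * c) - c * (s * b + t * d) = s * (a * d - b * c) := by ring
    have e₂ : (a : ℝ) * (s * b + t * d) - b * (s * a + t * c) = t * (a * d - b * c) := by ring
    rw [e₁, e₂]
    exact ⟨⟨mul_pos hs0 h, mul_lt_of_lt_one_left h hs1⟩,
      ⟨mul_pos ht0 h, mul_lt_of_lt_one_left h ht1⟩⟩
  · rintro ⟨⟨h₁, h₂⟩, h₃, h₄⟩
    refine ⟨(d * x - c * y) / (a * d - b * c), (a * y - b * x) / (a * d - b * c),
      div_pos h₁ h, (div_lt_one h).2 h₂, div_pos h₃ h, (div_lt_one h).2 h₄, ?_⟩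
    have h' := h.ne'
    refine Prod.ext ?_ ?_
    · simp only [div_mul_eq_mul_div, ← add_div]
      rw [eq_div_iff h']
      ring
    · simp only [div_mul_eq_mul_div, ← add_div]
      rw [eq_div_iff h']
      ring

/-- The lattice points of the parallelogram on the line `u = k / m`, by integer inequalities. -/
theorem mem_para_and_uFun_eq_iff {a₁ a₂ n m₁ m₂ m k : ℤ} (ha₁ : 0 < a₁) (ha₂ : 0 < a₂)
    (hn : 0 < n) (hm : m = m₁ * a₂ + m₂ * a₁ + n * (a₁ * a₂)) (hk0 : 0 < k) (hkm : k < m)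
    (x y : ℤ) :
    (((x : ℝ), (y : ℝ)) ∈ para (a₁ * n + m₁) m₂ m₁ (a₂ * n + m₂) ∧
      uFun (a₁ * n + m₁) m₂ m₁ (a₂ * n + m₂) ((x : ℝ), (y : ℝ)) = (k : ℝ) / (m : ℝ)) ↔
    a₂ * x + a₁ * y = k ∧ m₁ * k < m * x ∧ m₂ * k < m * y := by
  have hm0 : 0 < m := hk0.trans hkm
  have hdet : (a₁ * n + m₁) * (a₂ * n + m₂) - m₂ * m₁ = n * m := by rw [hm]; ring
  have hnm : 0 < n * m := mul_pos hn hm0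
  have hdetR : (((a₁ * n + m₁ : ℤ) : ℝ)) * ((a₂ * n + m₂ : ℤ) : ℝ) - (m₂ : ℝ) * m₁
      = (n : ℝ) * m := by exact_mod_cast hdet
  have hnmR : (0 : ℝ) < (n : ℝ) * m := by exact_mod_cast hnm
  have hu : uFun (a₁ * n + m₁) m₂ m₁ (a₂ * n + m₂) ((x : ℝ), (y : ℝ)) = (k : ℝ) / (m : ℝ) ↔
      a₂ * x + a₁ * y = k := by
    have hmR : (m : ℝ) ≠ 0 := by exact_mod_cast hm0.ne'
    have hnR : (n : ℝ) ≠ 0 := by exact_mod_cast hn.ne'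
    have e : uFun (a₁ * n + m₁) m₂ m₁ (a₂ * n + m₂) ((x : ℝ), (y : ℝ)) =
        (a₂ * x + a₁ * y : ℝ) / m := by
      rw [uFun, hdetR, ← mul_div_mul_left (a₂ * x + a₁ * y : ℝ) (m : ℝ) hnR]
      push_cast
      ring
    rw [e, div_left_inj' hmR]
    exact_mod_cast Iff.rfl
  rw [hu, mem_para_iff (by rw [hdetR]; exact hnmR), hdetR, and_comm]
  refine and_congr_right fun hline => ?_
  have e₁ : a₁ * ((a₂ * n + m₂) * x - m₁ * y) = m * x - m₁ * k := by
    rw [hm, ← hline]; ring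
  have e₂ : a₂ * ((a₁ * n + m₁) * y - m₂ * x) = m * y - m₂ * k := by
    rw [hm, ← hline]; ring
  have hsum : ((a₂ * n + m₂) * x - m₁ * y) + ((a₁ * n + m₁) * y - m₂ * x) = n * k := by
    rw [← hline]; ring
  have hlt : n * k < n * m := mul_lt_mul_of_pos_left hkm hn
  rw [← sub_pos (b := m₁ * k), ← sub_pos (b := m₂ * k), ← e₁, ← e₂,
    mul_pos_iff_of_pos_left ha₁, mul_pos_iff_of_pos_left ha₂]
  norm_cast
  constructor
  · rintro ⟨⟨h₁, -⟩, h₂, -⟩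
    exact ⟨h₁, h₂⟩
  · rintro ⟨h₁, h₂⟩
    exact ⟨⟨h₁, by linarith⟩, h₂, by linarith⟩

theorem bijection_onto_lattice_points_on_line
    (a₁ a₂ n m₁ m₂ b₁ b₂ m : ℤ) (s₁ s₂ : ℚ)
    (ha₁ : 0 < a₁) (ha₂ : 0 < a₂) (hcop : IsCoprime a₁ a₂) (hn : 0 < n)
    (hm₁ : m₁ = 0 ∨ m₁ = 1) (hm₂ : m₂ = 0 ∨ m₂ = 1)
    (hb : a₁ * b₂ + a₂ * b₁ = 1)
    (hm : m = m₁ * a₂ + m₂ * a₁ + n * (a₁ * a₂))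
    (hs₁ : s₁ = ((m₁ : ℚ) - b₁ * m) / a₁) (hs₂ : s₂ = ((m₂ : ℚ) - b₂ * m) / a₂)
    (k : ℤ) (hk0 : 0 < k) (hkm : k < m) :
    Set.BijOn (fun l : ℤ => (b₁ * k + a₁ * l, b₂ * k - a₂ * l))
      {l : ℤ | s₁ * k / m < (l : ℚ) ∧ (l : ℚ) < -(s₂ * k / m)}
      {p : ℤ × ℤ | ((p.1 : ℝ), (p.2 : ℝ)) ∈ para (a₁ * n + m₁) m₂ m₁ (a₂ * n + m₂) ∧
        uFun (a₁ * n + m₁) m₂ m₁ (a₂ * n + m₂) ((p.1 : ℝ), (p.2 : ℝ)) = (k : ℝ) / (m : ℝ)} ∧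
    {l : ℤ | s₁ * k / m < (l : ℚ) ∧ (l : ℚ) < -(s₂ * k / m)}.ncard =
      Mcount (a₁ * n + m₁) m₂ m₁ (a₂ * n + m₂) ((k : ℝ) / (m : ℝ)) := by
  have hm0 : 0 < m := hk0.trans hkm
  have ha₁Q : (0 : ℚ) < a₁ := by exact_mod_cast ha₁
  have ha₂Q : (0 : ℚ) < a₂ := by exact_mod_cast ha₂
  have hmQ : (0 : ℚ) < m := by exact_mod_cast hm0
  have hl₁ (l : ℤ) : s₁ * k / m < (l : ℚ) ↔ m₁ * k < m * (b₁ * k + a₁ * l) := by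
    rw [hs₁, div_mul_eq_mul_div, div_div, div_lt_iff₀ (mul_pos ha₁Q hmQ)]
    norm_cast
    constructor <;> intro h <;> linarith
  have hl₂ (l : ℤ) : (l : ℚ) < -(s₂ * k / m) ↔ m₂ * k < m * (b₂ * k - a₂ * l) := by
    rw [hs₂, div_mul_eq_mul_div, div_div, ← neg_div, lt_div_iff₀ (mul_pos ha₂Q hmQ)]
    norm_cast
    constructor <;> intro h <;> linarith
  have hbij : Set.BijOn (fun l : ℤ => (b₁ * k + a₁ * l, b₂ * k - a₂ * l))
      {l : ℤ | s₁ * k / m < (l : ℚ) ∧ (l : ℚ) < -(s₂ * k / m)}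
      {p : ℤ × ℤ | ((p.1 : ℝ), (p.2 : ℝ)) ∈ para (a₁ * n + m₁) m₂ m₁ (a₂ * n + m₂) ∧
        uFun (a₁ * n + m₁) m₂ m₁ (a₂ * n + m₂) ((p.1 : ℝ), (p.2 : ℝ)) =
          (k : ℝ) / (m : ℝ)} := by
    simp only [hl₁, hl₂, mem_para_and_uFun_eq_iff ha₁ ha₂ hn hm hk0 hkm]
    refine ⟨fun l hl => ⟨?_, hl⟩, fun l _ l' _ h => ?_, ?_⟩
    · linear_combination k * hb
    · have h₁ : b₁ * k + a₁ * l = b₁ * k + a₁ * l' := congrArg Prod.fst h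
      exact mul_left_cancel₀ ha₁.ne' (add_left_cancel h₁)
    · rintro ⟨x, y⟩ ⟨hline, hx, hy⟩
      have ex : b₁ * k + a₁ * (b₂ * x - b₁ * y) = x := by
        linear_combination x * hb - b₁ * hline
      have ey : b₂ * k - a₂ * (b₂ * x - b₁ * y) = y := by
        linear_combination y * hb - b₂ * hline
      refine ⟨b₂ * x - b₁ * y, ⟨?_, ?_⟩, Prod.ext ex ey⟩
      · rwa [ex]
      · rwa [ey]
  refine ⟨hbij, ?_⟩
  rw [Mcount, ← hbij.image_eq, hbij.injOn.ncard_image]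
end

section
/- Assume the Seifert data, let k be an integer with 0 < k < m, and set θ = k/m, (a,b) = (a₁n + m₁, m₂), (c,d) = (m₁, a₂n + m₂). Then: s₂k/m is an integer if and only if the point θ·(a,b) belongs to ℤ², and s₁k/m is an integer if and only if the point θ·(c,d) belongs to ℤ². (These two points are exactly the intersection points of the line {u = θ} with the boundary of the parallelogram Π(a,b,c,d).) -/
/-- `latticePt P` means the point `P ∈ ℝ²` has integer coordinates. -/
def latticePt (P : ℝ × ℝ) : Prop :=
  (∃ x : ℤ, (x : ℝ) = P.1) ∧ (∃ y : ℤ, (y : ℝ) = P.2)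

theorem exists_intCast_eq_div_mul_iff {K : Type*} [Field K] [CharZero K] {m : ℤ} (hm : m ≠ 0)
    (k x : ℤ) : (∃ j : ℤ, (j : K) = (k : K) / (m : K) * (x : K)) ↔ m ∣ k * x := by
  have hm' : (m : K) ≠ 0 := Int.cast_ne_zero.mpr hm
  refine exists_congr fun j => ?_
  rw [div_mul_eq_mul_div, eq_div_iff hm', mul_comm (j : K), eq_comm]
  exact_mod_cast Iff.rfl

/-- With `m = a₂ * p + q * a₁` and `a₁ * b₂ + a₂ * b₁ = 1`, the number `(q - b₂ * m) / a₂` is the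
integer `b₁ * q - b₂ * p`, and it generates the same ideal modulo `m` as `p` and `q`. -/
theorem exists_intCast_eq_div_iff_dvd {a₁ a₂ b₁ b₂ m p q k : ℤ} {s : ℚ} (ha₂ : a₂ ≠ 0)
    (hm0 : m ≠ 0) (hb : a₁ * b₂ + a₂ * b₁ = 1) (hm : m = a₂ * p + q * a₁)
    (hs : s = ((q : ℚ) - b₂ * m) / a₂) :
    (∃ j : ℤ, (j : ℚ) = s * k / m) ↔ m ∣ k * p ∧ m ∣ k * q := by
  have hs' : s = ((b₁ * q - b₂ * p : ℤ) : ℚ) := by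
    rw [hs, div_eq_iff (Int.cast_ne_zero.mpr ha₂)]
    norm_cast
    linear_combination (-b₂) * hm - q * hb
  have hcomm : s * k / m = (k : ℚ) / (m : ℚ) * ((b₁ * q - b₂ * p : ℤ) : ℚ) := by
    rw [← hs']; ring
  rw [hcomm, exists_intCast_eq_div_mul_iff hm0]
  constructor
  · rintro ⟨j, hj⟩
    exact ⟨⟨k * b₁ - a₁ * j, by linear_combination (-k * p) * hb - k * b₁ * hm - a₁ * hj⟩,
      ⟨k * b₂ + a₂ * j, by linear_combination (-k * q) * hb - k * b₂ * hm + a₂ * hj⟩⟩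
  · rintro ⟨⟨i, hi⟩, ⟨j, hj⟩⟩
    exact ⟨b₁ * j - b₂ * i, by linear_combination b₁ * hj - b₂ * hi⟩

theorem latticePt_div_mul_iff {m : ℤ} (hm : m ≠ 0) (k x y : ℤ) :
    latticePt ((k : ℝ) / (m : ℝ) * (x : ℝ), (k : ℝ) / (m : ℝ) * (y : ℝ)) ↔
      m ∣ k * x ∧ m ∣ k * y :=
  and_congr (exists_intCast_eq_div_mul_iff hm k x) (exists_intCast_eq_div_mul_iff hm k y)

theorem integrality_iff_boundary_lattice_point
    (a₁ a₂ n m₁ m₂ b₁ b₂ m : ℤ) (s₁ s₂ : ℚ)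
    (ha₁ : 0 < a₁) (ha₂ : 0 < a₂) (hcop : IsCoprime a₁ a₂) (hn : 0 < n)
    (hm₁ : m₁ = 0 ∨ m₁ = 1) (hm₂ : m₂ = 0 ∨ m₂ = 1)
    (hb : a₁ * b₂ + a₂ * b₁ = 1)
    (hm : m = m₁ * a₂ + m₂ * a₁ + n * (a₁ * a₂))
    (hs₁ : s₁ = ((m₁ : ℚ) - b₁ * m) / a₁) (hs₂ : s₂ = ((m₂ : ℚ) - b₂ * m) / a₂)
    (k : ℤ) (hk0 : 0 < k) (hkm : k < m) :
    ((∃ j : ℤ, (j : ℚ) = s₂ * k / m) ↔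
      latticePt (((k : ℝ) / (m : ℝ)) * ((a₁ * n + m₁ : ℤ) : ℝ),
        ((k : ℝ) / (m : ℝ)) * ((m₂ : ℤ) : ℝ))) ∧
    ((∃ j : ℤ, (j : ℚ) = s₁ * k / m) ↔
      latticePt (((k : ℝ) / (m : ℝ)) * ((m₁ : ℤ) : ℝ),
        ((k : ℝ) / (m : ℝ)) * ((a₂ * n + m₂ : ℤ) : ℝ))) := by
  have hm0 : m ≠ 0 := (hk0.trans hkm).ne'
  rw [latticePt_div_mul_iff hm0, latticePt_div_mul_iff hm0]
  constructor
  · exact exists_intCast_eq_div_iff_dvd ha₂.ne' hm0 hb (by linear_combination hm) hs₂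
  · rw [and_comm]
    exact exists_intCast_eq_div_iff_dvd (a₁ := a₂) (b₁ := b₂) ha₁.ne' hm0 (by linear_combination hb)
      (by linear_combination hm) hs₁
end
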